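/- (Corollary B) Every nonempty inverse subsemigroup S of FI₁ is finitely generated modulo its semilattice of idempotents: there exists a finite set A ⊆ S such that S = ⟨E(S) ∪ A⟩. -/

import Mathlib

/-- Multiplication on triples modeling the monogenic free inverse semigroup:
the triple `(a, p, b)` encodes the element written `(-a, p, b)` in the paper. -/
def FI1mul (u v : ℤ × ℤ × ℤ) : ℤ × ℤ × ℤ :=
  (max u.1 (v.1 - u.2.1), u.2.1 + v.2.1, max u.2.2 (v.2.2 + u.2.1))

/-- Inversion on triples: `(a, p, b)⁻¹ = (a + p, -p, b - p)`. -/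
def FI1inv (u : ℤ × ℤ × ℤ) : ℤ × ℤ × ℤ :=
  (u.1 + u.2.1, -u.2.1, u.2.2 - u.2.1)

/-- The monogenic free inverse semigroup in its concrete triple model:
triples `(a, p, b)` with `a, b ∈ ℕ`, `a + b > 0` and `-a ≤ p ≤ b`. -/
def FI1 : Set (ℤ × ℤ × ℤ) :=
  {u | 0 ≤ u.1 ∧ 0 ≤ u.2.2 ∧ 0 < u.1 + u.2.2 ∧ -u.1 ≤ u.2.1 ∧ u.2.1 ≤ u.2.2}

/-- Membership in the smallest subset containing `X` that is closed under
multiplication and inversion. -/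
inductive FI1genMem (X : Set (ℤ × ℤ × ℤ)) : ℤ × ℤ × ℤ → Prop
  | base {u : ℤ × ℤ × ℤ} : u ∈ X → FI1genMem X u
  | mul {u v : ℤ × ℤ × ℤ} : FI1genMem X u → FI1genMem X v → FI1genMem X (FI1mul u v)
  | inv {u : ℤ × ℤ × ℤ} : FI1genMem X u → FI1genMem X (FI1inv u)

/-- `⟨X⟩`: the smallest subset containing `X` closed under multiplication and inversion. -/
def FI1gen (X : Set (ℤ × ℤ × ℤ)) : Set (ℤ × ℤ × ℤ) := {u | FI1genMem X u}

/-- A (nonempty) inverse subsemigroup of `FI₁`. -/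
def IsInvSub (S : Set (ℤ × ℤ × ℤ)) : Prop :=
  S.Nonempty ∧ S ⊆ FI1 ∧ (∀ u ∈ S, ∀ v ∈ S, FI1mul u v ∈ S) ∧ ∀ u ∈ S, FI1inv u ∈ S

theorem FI1inv_FI1inv (u : ℤ × ℤ × ℤ) : FI1inv (FI1inv u) = u := by
  ext <;> simp [FI1inv]

theorem FI1mul_self_iff (u : ℤ × ℤ × ℤ) : FI1mul u u = u ↔ u.2.1 = 0 := by
  constructor
  · intro h
    have := congrArg (fun x => x.2.1) h
    simp only [FI1mul] at this
    omega
  · intro h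
    ext <;> simp [FI1mul, h]

/-- An inverse subsemigroup contains the subsemigroup generated by any of its subsets. -/
theorem FI1gen_subset {S X : Set (ℤ × ℤ × ℤ)} (hS : IsInvSub S) (hX : X ⊆ S) :
    FI1gen X ⊆ S := by
  intro u hu
  induction hu with
  | base h => exact hX h
  | mul _ _ h₁ h₂ => exact hS.2.2.1 _ h₁ _ h₂
  | inv _ h => exact hS.2.2.2 _ h

/-- The range idempotent `u * u⁻¹` of an element of an inverse subsemigroup. -/
theorem IsInvSub.range_mem {S : Set (ℤ × ℤ × ℤ)} (hS : IsInvSub S) {a p b : ℤ}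
    (hu : (a, p, b) ∈ S) : (a, 0, b) ∈ S := by
  have h := hS.2.2.1 _ hu _ (hS.2.2.2 _ hu)
  simpa [FI1mul, FI1inv] using h

/-- Dickson's lemma for sets of integer triples with nonnegative entries. -/
theorem exists_finset_forall_le {T : Set (ℤ × ℤ × ℤ)}
    (hT : ∀ u ∈ T, 0 ≤ u.1 ∧ 0 ≤ u.2.1 ∧ 0 ≤ u.2.2) :
    ∃ A : Finset (ℤ × ℤ × ℤ), ↑A ⊆ T ∧ ∀ u ∈ T, ∃ w ∈ A, w ≤ u := by
  classical
  let f : ℕ × ℕ × ℕ → ℤ × ℤ × ℤ := fun x => (x.1, x.2.1, x.2.2)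
  have hfin : {x | Minimal (fun y => f y ∈ T) x}.Finite :=
    WellQuasiOrderedLE.finite_of_isAntichain (setOfPred_minimal_antichain _)
  refine ⟨hfin.toFinset.image f, ?_, ?_⟩
  · intro u hu
    obtain ⟨x, hx, rfl⟩ := by simpa only [Finset.coe_image, Set.mem_image] using hu
    exact Minimal.prop (P := fun y => f y ∈ T) (hfin.mem_toFinset.1 hx)
  · rintro ⟨a, p, b⟩ hu
    obtain ⟨ha, hp, hb⟩ := hT _ hu
    lift a to ℕ using ha
    lift p to ℕ using hp
    lift b to ℕ using hb
    obtain ⟨x, hle, hx⟩ := exists_minimal_le_of_wellFoundedLT (fun y => f y ∈ T) (a, p, b) hu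
    refine ⟨f x, Finset.mem_image_of_mem f (hfin.mem_toFinset.2 hx), ?_⟩
    exact ⟨Int.ofNat_le.2 hle.1, Int.ofNat_le.2 hle.2.1, Int.ofNat_le.2 hle.2.2⟩

/-- If every element with positive middle component dominates some generator with positive
middle component, then all elements with nonnegative middle component are generated. -/
theorem IsInvSub.mem_gen_of_nonneg {S A : Set (ℤ × ℤ × ℤ)} (hS : IsInvSub S)
    (hA : A ⊆ {u | u ∈ S ∧ 0 < u.2.1})
    (hle : ∀ u ∈ S, 0 < u.2.1 → ∃ w ∈ A, w ≤ u) (n : ℕ) :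
    ∀ u ∈ S, u.2.1 = n → u ∈ FI1gen ({e | e ∈ S ∧ FI1mul e e = e} ∪ A) := by
  induction n using Nat.strong_induction_on with
  | _ n ih =>
    rintro ⟨a, p, b⟩ hu hp
    obtain rfl : p = n := hp
    rcases Nat.eq_zero_or_pos n with rfl | hn
    · exact .base (Or.inl ⟨hu, (FI1mul_self_iff _).2 rfl⟩)
    obtain ⟨⟨α, q, β⟩, hw, hα, hq, hβ⟩ := hle _ hu (Int.natCast_pos.2 hn)
    obtain ⟨hwS, hq0⟩ := hA hw
    dsimp only at hα hq hβ hq0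
    have he := hS.range_mem hu
    have hew : FI1mul (a, 0, b) (α, q, β) = (a, q, b) := by
      simp [FI1mul, hα, hβ]
    have hv : FI1mul (FI1inv (a, q, b)) (a, n, b) = (a + q, n - q, b - q) := by
      ext <;> simp [FI1mul, FI1inv]
      ring
    have hvS : (a + q, (n : ℤ) - q, b - q) ∈ S := by
      rw [← hv, ← hew]
      exact hS.2.2.1 _ (hS.2.2.2 _ (hS.2.2.1 _ he _ hwS)) _ hu
    have hfac : ((a, (n : ℤ), b) : ℤ × ℤ × ℤ) =
        FI1mul (FI1mul (a, 0, b) (α, q, β)) (a + q, n - q, b - q) := by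
      rw [hew]
      ext <;> simp [FI1mul]
    rw [hfac]
    refine .mul (.mul (.base (Or.inl ⟨he, (FI1mul_self_iff _).2 rfl⟩)) (.base (Or.inr hw))) ?_
    exact ih (n - q).toNat (by omega) _ hvS (by dsimp only; omega)

theorem stmt_15 (S : Set (ℤ × ℤ × ℤ)) (hS : IsInvSub S) :
    ∃ A : Finset (ℤ × ℤ × ℤ), ↑A ⊆ S ∧
      S = FI1gen ({e | e ∈ S ∧ FI1mul e e = e} ∪ ↑A) := by
  obtain ⟨A, hA, hle⟩ := exists_finset_forall_le (T := {u | u ∈ S ∧ 0 < u.2.1})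
    (fun u hu => ⟨(hS.2.1 hu.1).1, hu.2.le, (hS.2.1 hu.1).2.1⟩)
  have hAS : (↑A : Set (ℤ × ℤ × ℤ)) ⊆ S := fun u hu => (hA hu).1
  have hgen := hS.mem_gen_of_nonneg hA (fun u hu hp => hle u ⟨hu, hp⟩)
  refine ⟨A, hAS, Set.Subset.antisymm (fun u hu => ?_)
    (FI1gen_subset hS (Set.union_subset (fun _ h => h.1) hAS))⟩
  rcases le_total 0 u.2.1 with hp | hp
  · exact hgen u.2.1.toNat u hu (by omega)
  · rw [← FI1inv_FI1inv u]
    exact .inv (hgen (-u.2.1).toNat _ (hS.2.2.2 u hu) (by simp only [FI1inv]; omega))
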